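/- Let ε ∈ [0,1/2) and T, S, K ∈ B(H). Suppose S and K are positive operators of norm one with K ≤ S (i.e., S − K is positive), and T ⊥ε_ω S. Then T ⊥^{2ε}_ω (S + K), i.e., ω(T + λ(S+K))² ≥ ω(T)² − 4ε ω(T) ω(λ(S+K)) for all λ ∈ ℂ. -/

import Mathlib

open Filter Topology
open scoped InnerProductSpace

variable {H : Type*} [NormedAddCommGroup H] [InnerProductSpace ℂ H] [CompleteSpace H]

/-- The numerical radius of a bounded operator `T`:
`ω(T) = sup {|⟨Tx, x⟩| : ‖x‖ = 1}`. -/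
noncomputable def nrad (T : H →L[ℂ] H) : ℝ :=
  sSup {r : ℝ | ∃ x : H, ‖x‖ = 1 ∧ r = ‖⟪x, T x⟫_ℂ‖}

/-- Approximate numerical-radius (Birkhoff) orthogonality:
`T ⊥ε_ω S` iff `ω(T + λS)² ≥ ω(T)² − 2ε ω(T) ω(λS)` for all `λ ∈ ℂ`. -/
def NradOrth (ε : ℝ) (T S : H →L[ℂ] H) : Prop :=
  ∀ μ : ℂ, nrad T ^ 2 - 2 * ε * nrad T * nrad (μ • S) ≤ nrad (T + μ • S) ^ 2

lemma norm_inner_le_nrad (T : H →L[ℂ] H) {x : H} (hx : ‖x‖ = 1) :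
    ‖⟪x, T x⟫_ℂ‖ ≤ nrad T := by
  refine le_csSup ⟨‖T‖, ?_⟩ ⟨x, hx, rfl⟩
  rintro r ⟨y, hy, rfl⟩
  calc ‖⟪y, T y⟫_ℂ‖ ≤ ‖y‖ * ‖T y‖ := norm_inner_le_norm _ _
    _ ≤ ‖T‖ := by simpa [hy] using T.le_opNorm y

lemma nrad_nonneg (T : H →L[ℂ] H) : 0 ≤ nrad T := by
  refine Real.sSup_nonneg ?_
  rintro r ⟨y, -, rfl⟩
  exact norm_nonneg _

lemma nrad_le {T : H →L[ℂ] H} {c : ℝ} (hc : 0 ≤ c)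
    (h : ∀ x : H, ‖x‖ = 1 → ‖⟪x, T x⟫_ℂ‖ ≤ c) : nrad T ≤ c := by
  refine Real.sSup_le ?_ hc
  rintro r ⟨y, hy, rfl⟩
  exact h y hy

lemma nrad_smul_le (c : ℂ) (T : H →L[ℂ] H) : nrad (c • T) ≤ ‖c‖ * nrad T := by
  refine nrad_le (mul_nonneg (norm_nonneg _) (nrad_nonneg T)) fun x hx => ?_
  rw [smul_apply, inner_smul_right, norm_mul]
  exact mul_le_mul_of_nonneg_left (norm_inner_le_nrad T hx) (norm_nonneg c)

/-- For any `c < ω(T)²` the square of the numerical radius is approached by a unit vector. -/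
lemma exists_lt_norm_inner_sq [Nontrivial H] (T : H →L[ℂ] H) {c : ℝ} (hc : c < nrad T ^ 2) :
    ∃ x : H, ‖x‖ = 1 ∧ c < ‖⟪x, T x⟫_ℂ‖ ^ 2 := by
  by_contra! hcon
  obtain ⟨x₀, hx₀⟩ := exists_norm_eq H zero_le_one
  have hc0 : 0 ≤ c := (sq_nonneg _).trans (hcon x₀ hx₀)
  have hle : nrad T ≤ √c :=
    nrad_le (Real.sqrt_nonneg _) fun x hx => Real.le_sqrt_of_sq_le (hcon x hx)
  have := pow_le_pow_left₀ (nrad_nonneg T) hle 2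
  rw [Real.sq_sqrt hc0] at this
  linarith

lemma norm_add_mul_ofReal_sq (t μ : ℂ) (s : ℝ) :
    ‖t + μ * s‖ ^ 2 = ‖t‖ ^ 2 + 2 * (t.re * μ.re + t.im * μ.im) * s + ‖μ‖ ^ 2 * s ^ 2 := by
  simp only [Complex.sq_norm, Complex.normSq_apply]
  simp
  ring

lemma inner_apply_eq_re {S : H →L[ℂ] H} (hS : IsSelfAdjoint S) (x : H) :
    ⟪x, S x⟫_ℂ = ((⟪x, S x⟫_ℂ).re : ℂ) := by
  have h := hS.isSymmetric.coe_re_inner_self_apply x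
  simpa using h.symm

/-- Numerical-radius orthogonality yields unit vectors almost attaining `ω(T)` along which the
first-order term of `‖⟪x, (T + μ S) x⟫‖²` is almost bounded below. -/
lemma NradOrth.exists_unit_vector [Nontrivial H] {ε : ℝ} (hε0 : 0 ≤ ε) {T S : H →L[ℂ] H}
    (hS : IsSelfAdjoint S) (h : NradOrth ε T S) (μ : ℂ) {r : ℝ} (hr : 0 < r) (hr1 : r ≤ 1) :
    ∃ x : H, ‖x‖ = 1 ∧
      nrad T ^ 2 - r * (2 * (ε * nrad T * (‖μ‖ * nrad S)) + 1 + (‖μ‖ * nrad S) ^ 2 +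
        2 * (nrad T * (‖μ‖ * nrad S))) ≤ ‖⟪x, T x⟫_ℂ‖ ^ 2 ∧
      -(2 * (ε * nrad T * (‖μ‖ * nrad S))) - r * (1 + (‖μ‖ * nrad S) ^ 2) ≤
        2 * ((⟪x, T x⟫_ℂ).re * μ.re + (⟪x, T x⟫_ℂ).im * μ.im) * (⟪x, S x⟫_ℂ).re := by
  have hT0 := nrad_nonneg T
  have hsm : nrad ((r * μ : ℂ) • S) ≤ r * (‖μ‖ * nrad S) := by
    have := nrad_smul_le (r * μ) S
    rwa [norm_mul, Complex.norm_of_nonneg hr.le, mul_assoc] at this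
  have hlow := h (r * μ)
  have hmul := mul_le_mul_of_nonneg_left hsm (mul_nonneg (mul_nonneg zero_le_two hε0) hT0)
  obtain ⟨x, hx, hlt⟩ := exists_lt_norm_inner_sq (T + (r * μ : ℂ) • S)
    (c := nrad (T + (r * μ : ℂ) • S) ^ 2 - r ^ 2) (by linarith [pow_pos hr 2])
  refine ⟨x, hx, ?_⟩
  have ht := norm_inner_le_nrad T hx
  have hs := norm_inner_le_nrad S hx
  have hsr := inner_apply_eq_re hS x
  have hexp : ⟪x, (T + (r * μ : ℂ) • S) x⟫_ℂ
      = ⟪x, T x⟫_ℂ + μ * ((r * (⟪x, S x⟫_ℂ).re : ℝ) : ℂ) := by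
    rw [add_apply, smul_apply, inner_add_right,
      inner_smul_right, hsr]
    push_cast
    simp only [Complex.ofReal_re]
    ring
  rw [hexp, norm_add_mul_ofReal_sq] at hlt
  rw [hsr, Complex.norm_real, Real.norm_eq_abs] at hs
  generalize ⟪x, T x⟫_ℂ = t at *
  generalize (⟪x, S x⟫_ℂ).re = s at *
  have hμs : ‖μ‖ * |s| ≤ ‖μ‖ * nrad S := mul_le_mul_of_nonneg_left hs (norm_nonneg μ)
  have hq : t.re * μ.re + t.im * μ.im ≤ ‖t‖ * ‖μ‖ ∧ -(‖t‖ * ‖μ‖) ≤ t.re * μ.re + t.im * μ.im := by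
    rw [and_comm, ← abs_le]
    refine (Complex.abs_re_le_norm (t * (starRingEnd ℂ) μ)).trans_eq' ?_ |>.trans_eq ?_
    · simp
    · simp
  generalize t.re * μ.re + t.im * μ.im = q at *
  have hqs : q * s ≤ nrad T * (‖μ‖ * nrad S) := calc
    q * s ≤ |q| * |s| := (le_abs_self _).trans_eq (abs_mul q s)
    _ ≤ (‖t‖ * ‖μ‖) * |s| :=
      mul_le_mul_of_nonneg_right (abs_le.2 ⟨hq.2, hq.1⟩) (abs_nonneg s)
    _ = ‖t‖ * (‖μ‖ * |s|) := mul_assoc _ _ _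
    _ ≤ nrad T * (‖μ‖ * nrad S) := mul_le_mul ht hμs (by positivity) hT0
  have hμs2 : ‖μ‖ ^ 2 * s ^ 2 ≤ (‖μ‖ * nrad S) ^ 2 := by
    rw [← sq_abs s, ← mul_pow]
    exact pow_le_pow_left₀ (by positivity) hμs 2
  have ht2 := pow_le_pow_left₀ (norm_nonneg t) ht 2
  have hr2 : r ^ 2 * (‖μ‖ ^ 2 * s ^ 2) ≤ r ^ 2 * (‖μ‖ * nrad S) ^ 2 :=
    mul_le_mul_of_nonneg_left hμs2 (sq_nonneg r)
  have hrr : r ^ 2 * (1 + (‖μ‖ * nrad S) ^ 2) ≤ r * (1 + (‖μ‖ * nrad S) ^ 2) :=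
    mul_le_mul_of_nonneg_right (by nlinarith) (by positivity)
  have hrq := mul_le_mul_of_nonneg_left hqs hr.le
  constructor
  · linarith
  · refine le_of_mul_le_mul_left ?_ hr
    linarith

/-- If `S` and `K` are positive operators of norm one with `K ≤ S`
(`S − K` positive) and `T ⊥ε_ω S` with `ε ∈ [0, 1/2)`, then `T ⊥^{2ε}_ω (S + K)`. -/
theorem nradOrth_add_of_le (ε : ℝ) (hε0 : 0 ≤ ε) (hε1 : ε < 1 / 2)
    (T S K : H →L[ℂ] H)
    (hSsa : IsSelfAdjoint S) (hSpos : ∀ x : H, 0 ≤ (⟪x, S x⟫_ℂ).re)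
    (hKsa : IsSelfAdjoint K) (hKpos : ∀ x : H, 0 ≤ (⟪x, K x⟫_ℂ).re)
    (hSnorm : ‖S‖ = 1) (hKnorm : ‖K‖ = 1)
    (hKS : IsSelfAdjoint (S - K) ∧ ∀ x : H, 0 ≤ (⟪x, (S - K) x⟫_ℂ).re)
    (h : NradOrth ε T S) :
    NradOrth (2 * ε) T (S + K) := by
  have : Nontrivial H := by
    by_contra hH
    rw [not_nontrivial_iff_subsingleton] at hH
    have : S = 0 := Subsingleton.elim _ _
    simp [this] at hSnorm
  intro μ
  have hT0 := nrad_nonneg T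
  have hmono : ‖μ‖ * nrad S ≤ nrad (μ • (S + K)) := by
    rw [mul_comm]
    rcases (norm_nonneg μ).eq_or_lt with h0 | hpos
    · simpa [← h0] using nrad_nonneg _
    rw [← le_div_iff₀ hpos]
    refine nrad_le (div_nonneg (nrad_nonneg _) hpos.le) fun x hx => ?_
    rw [le_div_iff₀ hpos]
    refine le_trans ?_ (norm_inner_le_nrad _ hx)
    rw [smul_apply, inner_smul_right, norm_mul, mul_comm,
      add_apply, inner_add_right, inner_apply_eq_re hSsa x,
      inner_apply_eq_re hKsa x, ← Complex.ofReal_add, Complex.norm_of_nonneg (hSpos x),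
      Complex.norm_of_nonneg (add_nonneg (hSpos x) (hKpos x))]
    exact mul_le_mul_of_nonneg_left (le_add_of_nonneg_right (hKpos x)) hpos.le
  have hA := mul_le_mul_of_nonneg_left hmono (mul_nonneg hε0 hT0)
  set A := ε * nrad T * (‖μ‖ * nrad S) with hAdef
  have hA0 : 0 ≤ A := by have := nrad_nonneg S; positivity
  set C := 1 + (‖μ‖ * nrad S) ^ 2 with hC
  set D := 2 * A + 1 + (‖μ‖ * nrad S) ^ 2 + 2 * (nrad T * (‖μ‖ * nrad S)) with hD
  have hC0 : 0 ≤ C := by positivity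
  have key : ∀ r : ℝ, 0 < r → r ≤ 1 →
      nrad T ^ 2 - 4 * A - r * (D + 2 * C) ≤ nrad (T + μ • (S + K)) ^ 2 := by
    intro r hr hr1
    obtain ⟨x, hx, h1, h2⟩ := h.exists_unit_vector hε0 hSsa μ hr hr1
    have hx2 := pow_le_pow_left₀ (norm_nonneg _) (norm_inner_le_nrad (T + μ • (S + K)) hx) 2
    have hexp : ⟪x, (T + μ • (S + K)) x⟫_ℂ
        = ⟪x, T x⟫_ℂ + μ * (((⟪x, S x⟫_ℂ).re + (⟪x, K x⟫_ℂ).re : ℝ) : ℂ) := by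
      rw [Complex.ofReal_add, ← inner_apply_eq_re hSsa, ← inner_apply_eq_re hKsa,
        add_apply, smul_apply, inner_add_right,
        inner_smul_right, add_apply, inner_add_right]
    rw [hexp, norm_add_mul_ofReal_sq] at hx2
    have hs := hSpos x
    have hk := hKpos x
    have hks := hKS.2 x
    rw [sub_apply, inner_sub_right, Complex.sub_re] at hks
    generalize (⟪x, S x⟫_ℂ).re = s at *
    generalize (⟪x, K x⟫_ℂ).re = k at *
    generalize (⟪x, T x⟫_ℂ).re * μ.re + (⟪x, T x⟫_ℂ).im * μ.im = q at *
    have hsq : 0 ≤ ‖μ‖ ^ 2 * (s + k) ^ 2 := by positivity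
    have hrC := mul_nonneg hr.le hC0
    have hmain : -(4 * A) - 2 * (r * C) ≤ 2 * q * (s + k) := by
      rcases le_total 0 q with hq | hq
      · have : 0 ≤ 2 * q * (s + k) := by positivity
        linarith
      · have := mul_nonneg_of_nonpos_of_nonpos hq (sub_nonpos.2 (sub_nonneg.1 hks))
        linarith
    linarith
  have hlim : Tendsto (fun r : ℝ => nrad T ^ 2 - 4 * A - r * (D + 2 * C)) (𝓝[>] 0)
      (𝓝 (nrad T ^ 2 - 4 * A)) := by
    have hc : Continuous fun r : ℝ => nrad T ^ 2 - 4 * A - r * (D + 2 * C) := by fun_prop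
    simpa using (hc.tendsto 0).mono_left nhdsWithin_le_nhds
  have hfin : nrad T ^ 2 - 4 * A ≤ nrad (T + μ • (S + K)) ^ 2 := by
    refine le_of_tendsto hlim ?_
    filter_upwards [Ioc_mem_nhdsGT zero_lt_one] with r hr using key r hr.1 hr.2
  linarith
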